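/- arXiv:1304.5460 — 2 statements merged into one kernel-verified Lean document; each statement's English description precedes it below -/
import Mathlib

section
/- Let J_n ∈ 𝒥_n with β = b_1 b_2 ⋯ b_n nonreal (Im β ≠ 0) and a_n ∈ ℝ. Then all eigenvalues of J_n are real and simple, and they strictly interlace the eigenvalues of the leading principal submatrix J_{n−1}: if λ_1 < ... < λ_n are the eigenvalues of J_n and μ_1 < ... < μ_{n−1} those of J_{n−1}, then λ_k < μ_k < λ_{k+1} for all k = 1,...,n−1. -/
open Polynomial Matrix Finset

noncomputable section

/-- The corner-bordered complex Jacobi matrix of the class `𝒥_n`: real diagonal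
entries `c 0, …, c (n−2)`, complex entry `a` at position `(n−1, n−1)`, superdiagonal
entries `b 0, …, b (n−2)` with their conjugates on the subdiagonal, and corner entries
`conj (b (n−1))` at `(0, n−1)` and `b (n−1)` at `(n−1, 0)`. -/
def cornerJacobi (n : ℕ) (c : ℕ → ℝ) (b : ℕ → ℂ) (a : ℂ) :
    Matrix (Fin n) (Fin n) ℂ :=
  Matrix.of fun i j =>
    if (i : ℕ) = (j : ℕ) then (if (i : ℕ) = n - 1 then a else ((c (i : ℕ) : ℝ) : ℂ))
    else if (i : ℕ) = 0 ∧ (j : ℕ) = n - 1 then (starRingEnd ℂ) (b (n - 1))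
    else if (i : ℕ) = n - 1 ∧ (j : ℕ) = 0 then b (n - 1)
    else if (i : ℕ) + 1 = (j : ℕ) then b (i : ℕ)
    else if (j : ℕ) + 1 = (i : ℕ) then (starRingEnd ℂ) (b (j : ℕ))
    else 0

/-- The leading principal `(n−1)×(n−1)` submatrix of `cornerJacobi n c b a`. -/
def cornerJacobiSub (n : ℕ) (c : ℕ → ℝ) (b : ℕ → ℂ) (a : ℂ) :
    Matrix (Fin (n - 1)) (Fin (n - 1)) ℂ :=
  (cornerJacobi n c b a).submatrix (Fin.castLE (Nat.sub_le n 1)) (Fin.castLE (Nat.sub_le n 1))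


theorem aux_herm (n : ℕ) (hn : 3 ≤ n) (c : ℕ → ℝ) (b : ℕ → ℂ) (a : ℝ) :
    (cornerJacobi n c b (a : ℂ)).IsHermitian := by
  ext i j
  rw [conjTranspose_apply]
  simp only [cornerJacobi, of_apply]
  have hi := i.2
  have hj := j.2
  split_ifs <;> first | omega | rfl | (simp; done) | skip
  all_goals (simp only [Complex.star_def, Complex.conj_ofReal]; grind)

/-- The core non-degeneracy statement, for sequences. -/
theorem aux_rec (m : ℕ) (hm : 2 ≤ m) (c : ℕ → ℝ) (b : ℕ → ℂ) (μ : ℝ)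
    (hb : ∀ k : ℕ, k < m + 1 → b k ≠ 0)
    (hβ : (∏ k ∈ Finset.range (m + 1), b k).im ≠ 0) (V : ℕ → ℂ)
    (h0 : (c 0 : ℂ) * V 0 + b 0 * V 1 = μ * V 0)
    (hstep : ∀ i, i + 2 < m →
      (starRingEnd ℂ) (b i) * V i + c (i+1) * V (i+1) + b (i+1) * V (i+2) = μ * V (i+1))
    (hlast : b m * V 0 + (starRingEnd ℂ) (b (m - 1)) * V (m - 1) = 0) :
    ∀ i < m, V i = 0 := by
  let P : ℕ → ℂ := fun i => ∏ k ∈ Finset.range i, b k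
  have hP : ∀ i, P (i+1) = P i * b i := fun i => Finset.prod_range_succ _ _
  have hP0 : ∀ i ≤ m + 1, P i ≠ 0 := fun i hi => Finset.prod_ne_zero_iff.2 fun k hk =>
    hb k (by rw [Finset.mem_range] at hk; omega)
  have hr : ∀ i, i + 1 < m → ∃ r r' : ℝ, P i * V i = r * V 0 ∧ P (i+1) * V (i+1) = r' * V 0 := by
    intro i
    induction i with
    | zero =>
      intro _
      refine ⟨1, μ - c 0, by simp [P], ?_⟩
      simp only [P, zero_add, Finset.prod_range_one]
      push_cast
      linear_combination h0
    | succ i ih =>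
      intro hi
      obtain ⟨r, r', h1, h2⟩ := ih (by omega)
      refine ⟨r', (μ - c (i+1)) * r' - Complex.normSq (b i) * r, h2, ?_⟩
      have := hstep i (by omega)
      have hN : ((Complex.normSq (b i) : ℝ) : ℂ) = b i * (starRingEnd ℂ) (b i) :=
        (Complex.mul_conj _).symm
      push_cast
      rw [hN, hP (i+1)]
      rw [hP i] at h2 ⊢
      linear_combination (P i * b i) * this + (μ - c (i+1)) * h2 - b i * (starRingEnd ℂ) (b i) * h1
  have hr' : ∀ i < m, ∃ r : ℝ, P i * V i = r * V 0 := by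
    intro i hi
    rcases i with _ | i
    · exact ⟨1, by simp [P]⟩
    · obtain ⟨_, r, _, h⟩ := hr i hi; exact ⟨r, h⟩
  have hV0 : V 0 = 0 := by
    by_contra hne
    obtain ⟨r, h⟩ := hr' (m - 1) (by omega)
    have hN : ((Complex.normSq (b (m-1)) : ℝ) : ℂ) = b (m-1) * (starRingEnd ℂ) (b (m-1)) :=
      (Complex.mul_conj _).symm
    have e1 : P m = P (m - 1) * b (m - 1) := by
      rw [← hP, Nat.sub_add_cancel (by omega)]
    have e2 : P (m + 1) = P m * b m := hP m
    have e3 : (P (m+1) + Complex.normSq (b (m-1)) * r) * V 0 = 0 := by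
      rw [hN, e2]
      linear_combination P m * hlast - b (m-1) * (starRingEnd ℂ) (b (m-1)) * h
        - (starRingEnd ℂ) (b (m - 1)) * V (m - 1) * e1
    have e4 := (mul_eq_zero.1 e3).resolve_right hne
    apply hβ
    have := congrArg Complex.im e4
    simpa [P] using this
  intro i hi
  obtain ⟨r, h⟩ := hr' i hi
  rw [hV0, mul_zero] at h
  exact (mul_eq_zero.1 h).resolve_left (hP0 i (by omega))

theorem aux_nondeg (m : ℕ) (hm : 2 ≤ m) (c : ℕ → ℝ) (b : ℕ → ℂ) (a : ℝ) (μ : ℝ)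
    (hb : ∀ k : ℕ, k < m + 1 → b k ≠ 0)
    (hβ : (∏ k ∈ Finset.range (m + 1), b k).im ≠ 0) (v : Fin m → ℂ)
    (hv : ((cornerJacobi (m + 1) c b (a : ℂ)).submatrix Fin.castSucc Fin.castSucc) *ᵥ v
      = (μ : ℂ) • v)
    (hlast : ∑ i, cornerJacobi (m + 1) c b (a : ℂ) (Fin.last m) i.castSucc * v i = 0) : v = 0 := by
  let V : ℕ → ℂ := fun i => if h : i < m then v ⟨i, h⟩ else 0
  have hVv : ∀ i : Fin m, V i = v i := fun i => by simp [V]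
  have hsum : ∀ i : Fin (m+1), ∀ S : Finset ℕ, S ⊆ Finset.range m →
      (∀ j : Fin m, (j : ℕ) ∉ S → cornerJacobi (m + 1) c b (a : ℂ) i j.castSucc = 0) →
      ∑ j, cornerJacobi (m + 1) c b (a : ℂ) i j.castSucc * v j
      = ∑ j ∈ S, cornerJacobi (m + 1) c b (a : ℂ) i (Fin.ofNat (m+1) j) * V j := by
    intro i S hS hz
    rw [Finset.sum_subset hS, Finset.sum_range]
    · refine Finset.sum_congr rfl fun j _ => ?_
      rw [hVv]
      congr 2
      ext; simp
    · intro j hj hj'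
      have hj := Finset.mem_range.1 hj
      have := hz ⟨j, hj⟩ hj'
      have e : Fin.ofNat (m+1) j = (⟨j, hj⟩ : Fin m).castSucc := by
        ext; simp; omega
      rw [e, this, zero_mul]
  have hrow : ∀ i : Fin m, ∑ j, cornerJacobi (m + 1) c b (a : ℂ) i.castSucc j.castSucc * v j
      = μ * V i := by
    intro i
    rw [hVv]
    exact congrFun hv i
  have hres := aux_rec m hm c b μ hb hβ V ?_ ?_ ?_
  · ext i; rw [← hVv, hres i i.2]; rfl
  · have h := hrow ⟨0, by omega⟩
    rw [hsum _ {0, 1} (by intro j; simp; omega) (by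
      intro j hj
      have := j.2
      simp only [Finset.mem_insert, Finset.mem_singleton] at hj
      simp only [cornerJacobi, of_apply, Fin.val_castSucc]
      split_ifs <;> first | omega | rfl | (exfalso; simp_all)), Finset.sum_pair (by norm_num)] at h
    rw [← h]
    congr 2
    · simp only [cornerJacobi, of_apply, Fin.val_castSucc, Fin.val_ofNat, Nat.zero_mod]
      rw [if_pos trivial, if_neg (by omega)]
    · have e : 1 % (m+1) = 1 := Nat.mod_eq_of_lt (by omega)
      simp only [cornerJacobi, of_apply, Fin.val_castSucc, Fin.val_ofNat, e]
      split_ifs <;> first | omega | rfl | (exfalso; simp_all)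
  · intro i hi
    have h := hrow ⟨i + 1, by omega⟩
    have e0 : i % (m+1) = i := Nat.mod_eq_of_lt (by omega)
    have e1 : (i + 1) % (m+1) = i + 1 := Nat.mod_eq_of_lt (by omega)
    have e2 : (i + 2) % (m+1) = i + 2 := Nat.mod_eq_of_lt (by omega)
    rw [hsum _ {i, i + 1, i + 2} (by intro j; simp; omega) (by
      intro j hj
      have := j.2
      simp only [Finset.mem_insert, Finset.mem_singleton] at hj
      simp only [cornerJacobi, of_apply, Fin.val_castSucc]
      split_ifs <;> first | omega | rfl | (exfalso; simp_all)), Finset.sum_insert (by simp), Finset.sum_pair (by simp)] at h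
    rw [← h, add_assoc]
    congr 2
    · simp only [cornerJacobi, of_apply, Fin.val_castSucc, Fin.val_ofNat, e0]
      split_ifs <;> first | omega | rfl | (exfalso; simp_all)
    · congr 1
      simp only [cornerJacobi, of_apply, Fin.val_castSucc, Fin.val_ofNat, e1]
      split_ifs <;> first | omega | rfl | (exfalso; simp_all)
    · congr 1
      simp only [cornerJacobi, of_apply, Fin.val_castSucc, Fin.val_ofNat, e2]
      split_ifs <;> first | omega | rfl | (exfalso; simp_all)
  · have e0 : (m - 1) % (m+1) = m - 1 := Nat.mod_eq_of_lt (by omega)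
    rw [hsum _ {0, m - 1} (by intro j; simp; omega) (by
      intro j hj
      have := j.2
      simp only [Finset.mem_insert, Finset.mem_singleton] at hj
      simp only [cornerJacobi, of_apply, Fin.val_castSucc, Fin.val_last]
      split_ifs <;> first | omega | rfl | (exfalso; simp_all)), Finset.sum_pair (by omega)] at hlast
    rw [← hlast]
    congr 2
    · simp only [cornerJacobi, of_apply, Fin.val_last, Fin.val_ofNat, Nat.zero_mod]
      split_ifs <;> first | omega | rfl | (exfalso; simp_all)
    · simp only [cornerJacobi, of_apply, Fin.val_last, Fin.val_ofNat, e0]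
      split_ifs <;> first | omega | rfl | (exfalso; simp_all)

theorem aux_diag {m : ℕ} (A : Matrix (Fin m) (Fin m) ℂ) (hA : A.IsHermitian)
    (μ : Fin m → ℝ) (hμ : Function.Injective μ)
    (hchar : A.charpoly = ∏ j, (X - C ((μ j : ℂ)))) :
    ∃ V : Matrix (Fin m) (Fin m) ℂ, Vᴴ * V = 1 ∧ A * V = V * diagonal (fun j => (μ j : ℂ)) := by
  have h1 : ∀ j, ∃ i, hA.eigenvalues i = μ j := by
    intro j
    have h2 : A.charpoly.eval (μ j : ℂ) = 0 := by
      rw [hchar, eval_prod]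
      exact Finset.prod_eq_zero (Finset.mem_univ j) (by simp)
    rw [hA.charpoly_eq, eval_prod, Finset.prod_eq_zero_iff] at h2
    obtain ⟨i, -, hi⟩ := h2
    refine ⟨i, ?_⟩
    simp only [eval_sub, eval_X, eval_C, sub_eq_zero] at hi
    exact (Complex.ofReal_injective hi).symm
  choose σ hσ using h1
  have hσi : Function.Injective σ := fun i j h => hμ (by rw [← hσ, ← hσ, h])
  refine ⟨(hA.eigenvectorUnitary : Matrix (Fin m) (Fin m) ℂ).submatrix id σ, ?_, ?_⟩
  · have hU : (hA.eigenvectorUnitary : Matrix (Fin m) (Fin m) ℂ)ᴴ * hA.eigenvectorUnitary = 1 :=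
      Unitary.coe_star_mul_self hA.eigenvectorUnitary
    ext i j
    have := congrFun (congrFun hU (σ i)) (σ j)
    simp only [Matrix.mul_apply, one_apply, hσi.eq_iff] at this ⊢
    rw [← this]
    rfl
  · ext i j
    have h := congrFun (hA.mulVec_eigenvectorBasis (σ j)) i
    rw [Matrix.mul_diagonal]
    simp only [mulVec, dotProduct, hσ, Pi.smul_apply] at h
    simp only [Matrix.mul_apply, submatrix_apply, id, Matrix.IsHermitian.eigenvectorUnitary_apply]
    rw [h, mul_comm]
    simp

theorem aux_secular {m : ℕ} (J : Matrix (Fin (m+1)) (Fin (m+1)) ℂ) (hJ : J.IsHermitian)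
    (a : ℝ) (ha : J (Fin.last m) (Fin.last m) = a)
    (μ : Fin m → ℝ) (hμ : Function.Injective μ)
    (hchar : (J.submatrix Fin.castSucc Fin.castSucc).charpoly = ∏ j, (X - C ((μ j : ℂ)))) :
    ∃ v : Fin m → Fin m → ℂ,
      (∀ j, v j ≠ 0 ∧ (J.submatrix Fin.castSucc Fin.castSucc) *ᵥ v j = (μ j : ℂ) • v j) ∧
      ∀ x : ℝ, J.charpoly.eval (x : ℂ) = (((x - a) * ∏ j, (x - μ j) -
        ∑ j, Complex.normSq (∑ i, J (Fin.last m) i.castSucc * v j i) *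
          ∏ i ∈ univ.erase j, (x - μ i) : ℝ) : ℂ) := by
  set A := J.submatrix Fin.castSucc Fin.castSucc with hAdef
  have hA : A.IsHermitian := hJ.submatrix _
  obtain ⟨V, hV, hAV⟩ := aux_diag A hA μ hμ hchar
  have hV' : V * Vᴴ = 1 := mul_eq_one_comm.mp hV
  refine ⟨fun j i => V i j, ?_, ?_⟩
  · intro j
    constructor
    · intro h0
      have := congrFun (congrFun hV j) j
      simp only [Matrix.mul_apply, one_apply_eq] at this
      have h1 : ∀ i, V i j = 0 := fun i => congrFun h0 i
      simp [h1] at this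
    · ext i
      have := congrFun (congrFun hAV i) j
      rw [Matrix.mul_diagonal] at this
      simp only [mulVec, dotProduct, Pi.smul_apply, smul_eq_mul]
      rw [Matrix.mul_apply] at this
      rw [this, mul_comm]
  · have key : ∀ x : ℝ, (∀ j, x ≠ μ j) → J.charpoly.eval (x : ℂ) = (((x - a) * ∏ j, (x - μ j) -
        ∑ j, Complex.normSq (∑ i, J (Fin.last m) i.castSucc * V i j) *
          ∏ i ∈ univ.erase j, (x - μ i) : ℝ) : ℂ) := by
      intro x hx
      have hx' : ∀ j, (x : ℂ) - μ j ≠ 0 := fun j => by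
        rw [sub_ne_zero]; exact_mod_cast hx j
      let r : Matrix (Fin 1) (Fin m) ℂ := Matrix.of fun _ i => J (Fin.last m) i.castSucc
      let D : Matrix (Fin m) (Fin m) ℂ := diagonal (fun j => (x : ℂ) - μ j)
      let E : Matrix (Fin m) (Fin m) ℂ := diagonal (fun j => ((x : ℂ) - μ j)⁻¹)
      have hDE : D * E = 1 := by
        simp only [D, E, diagonal_mul_diagonal]
        rw [← diagonal_one]
        congr 1; ext j; exact mul_inv_cancel₀ (hx' j)
      have hxA : Matrix.scalar _ (x : ℂ) - A = V * D * Vᴴ := by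
        have h1 : D = Matrix.scalar _ (x : ℂ) - diagonal (fun j => (μ j : ℂ)) := by
          simp only [D, Matrix.scalar_apply, diagonal_sub]
        rw [h1, mul_sub, sub_mul, ← hAV, Matrix.mul_assoc A, hV', mul_one]
        rw [← (Matrix.scalar_commute (x : ℂ) (fun r => Commute.all _ _) V).eq, Matrix.mul_assoc, hV', mul_one]
      have hinv : (V * D * Vᴴ) * (V * E * Vᴴ) = 1 := by
        calc _ = V * D * (Vᴴ * V) * E * Vᴴ := by simp only [Matrix.mul_assoc]
          _ = V * (D * E) * Vᴴ := by rw [hV]; simp only [Matrix.mul_assoc, Matrix.one_mul]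
          _ = 1 := by rw [hDE, mul_one, hV']
      let _ : Invertible (V * D * Vᴴ) := invertibleOfRightInverse _ _ hinv
      have hio : ⅟(V * D * Vᴴ) = V * E * Vᴴ := rfl
      have hblock : (Matrix.scalar _ (x : ℂ) - J).submatrix (finSumFinEquiv (m := m) (n := 1))
          (finSumFinEquiv (m := m) (n := 1)) = fromBlocks (V * D * Vᴴ) (-rᴴ) (-r)
            (Matrix.of fun _ _ => (x : ℂ) - a) := by
        rw [← hxA]
        ext i j
        rcases i with i | i <;> rcases j with j | j
        · simp only [submatrix_apply, finSumFinEquiv_apply_left, fromBlocks_apply₁₁, Matrix.sub_apply, hAdef,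
            scalar_apply, diagonal_apply]
          congr 1
          simp [Fin.ext_iff]
        · simp only [submatrix_apply, finSumFinEquiv_apply_left, finSumFinEquiv_apply_right,
            fromBlocks_apply₁₂, Matrix.sub_apply, scalar_apply, Matrix.neg_apply, conjTranspose_apply, r, of_apply]
          rw [hJ.apply, diagonal_apply_ne, zero_sub]
          · congr 2; ext; simp [Subsingleton.elim j 0]
          · intro h; simp [Fin.ext_iff] at h; omega
        · simp only [submatrix_apply, finSumFinEquiv_apply_left, finSumFinEquiv_apply_right,
            fromBlocks_apply₂₁, Matrix.sub_apply, scalar_apply, Matrix.neg_apply, r, of_apply]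
          rw [diagonal_apply_ne, zero_sub]
          · congr 2; ext; simp [Subsingleton.elim i 0]
          · intro h; simp [Fin.ext_iff] at h; omega
        · have hi : (Fin.natAdd m i) = Fin.last m := by ext; simp [Subsingleton.elim i 0]
          have hj : (Fin.natAdd m j) = Fin.last m := by ext; simp [Subsingleton.elim j 0]
          simp only [submatrix_apply, finSumFinEquiv_apply_right,
            fromBlocks_apply₂₂, Matrix.sub_apply, scalar_apply, of_apply]
          rw [hi, hj, ha, diagonal_apply_eq]
      rw [Matrix.eval_charpoly, ← det_submatrix_equiv_self (finSumFinEquiv (m := m) (n := 1)), hblock,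
        det_fromBlocks₁₁, hio]
      have hdet : (V * D * Vᴴ).det = ∏ j, ((x : ℂ) - μ j) := by
        rw [det_mul, mul_comm, ← det_mul, ← Matrix.mul_assoc, hV, one_mul, det_diagonal]
      rw [hdet, det_fin_one]
      have hz : (r * (V * E * Vᴴ) * rᴴ) 0 0
          = ∑ j, (Complex.normSq (∑ i, J (Fin.last m) i.castSucc * V i j) : ℂ) * ((x : ℂ) - μ j)⁻¹ := by
        have : r * (V * E * Vᴴ) * rᴴ = (r * V) * E * (r * V)ᴴ := by
          rw [conjTranspose_mul]; simp only [Matrix.mul_assoc]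
        rw [this, Matrix.mul_apply]
        refine Finset.sum_congr rfl fun j _ => ?_
        rw [Matrix.mul_diagonal, conjTranspose_apply, Matrix.mul_apply]
        simp only [r, of_apply]
        rw [mul_right_comm, Complex.star_def, Complex.mul_conj]
      simp only [Matrix.sub_apply, of_apply, Matrix.neg_mul, Matrix.mul_neg, neg_neg]
      rw [hz, mul_sub, Finset.mul_sum]
      push_cast
      congr 1
      · ring
      · refine Finset.sum_congr rfl fun j _ => ?_
        rw [← Finset.mul_prod_erase univ _ (Finset.mem_univ j)]
        field_simp [hx' j]
    have hd : Dense ((Set.range μ)ᶜ) := by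
      have := (dense_univ (X := ℝ)).sdiff_finite (Set.finite_range μ)
      rwa [← Set.compl_eq_univ_sdiff] at this
    intro x
    refine congrFun (Continuous.ext_on hd (f := fun x : ℝ => J.charpoly.eval (x : ℂ)) (g := fun x : ℝ => (((x - a) * ∏ j, (x - μ j) -
        ∑ j, Complex.normSq (∑ i, J (Fin.last m) i.castSucc * V i j) *
          ∏ i ∈ univ.erase j, (x - μ i) : ℝ) : ℂ)) ?_ ?_ ?_) x
    · exact J.charpoly.continuous.comp Complex.continuous_ofReal
    · fun_prop
    · intro y hy
      exact key y (fun j h => hy ⟨j, h.symm⟩)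

theorem aux_sign {m : ℕ} (k : ℕ) (s : Finset (Fin m)) (y : Fin m → ℝ)
    (h1 : ∀ j ∈ s, (j : ℕ) < k → 0 < y j) (h2 : ∀ j ∈ s, k ≤ (j : ℕ) → y j < 0) :
    0 < (-1 : ℝ) ^ #(s.filter fun j : Fin m => k ≤ (j : ℕ)) * ∏ j ∈ s, y j := by
  rw [← Finset.prod_const, Finset.prod_filter, ← Finset.prod_mul_distrib]
  refine Finset.prod_pos fun j hj => ?_
  split_ifs with h
  · have := h2 j hj h; linarith
  · have := h1 j hj (by omega); linarith

theorem aux_card {m : ℕ} (k : ℕ) : #(univ.filter fun j : Fin m => k ≤ (j : ℕ)) = m - k := by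
  have h : (univ.filter fun j : Fin m => k ≤ (j : ℕ)).map Fin.valEmbedding = Finset.Ico k m := by
    ext i
    simp only [Finset.mem_map, Finset.mem_filter, Finset.mem_univ, true_and, Fin.valEmbedding_apply,
      Finset.mem_Ico]
    constructor
    · rintro ⟨j, hj, rfl⟩; exact ⟨hj, j.2⟩
    · rintro ⟨h1, h2⟩; exact ⟨⟨i, h2⟩, h1, rfl⟩
  rw [← Finset.card_map Fin.valEmbedding, h, Nat.card_Ico]

theorem aux_roots {m : ℕ} (a : ℝ) (μ s : Fin m → ℝ) (hμ : StrictMono μ) (hs : ∀ j, 0 < s j)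
    (q : ℝ → ℝ) (hq : ∀ x, q x = (x - a) * ∏ j, (x - μ j) -
        ∑ j, s j * ∏ i ∈ univ.erase j, (x - μ i)) :
    ∃ lam : Fin (m+1) → ℝ, (∀ k, q (lam k) = 0) ∧
      ∀ k : Fin m, lam k.castSucc < μ k ∧ μ k < lam k.succ := by
  have hqc : Continuous q := by
    have : q = fun x => (x - a) * ∏ j, (x - μ j) -
        ∑ j, s j * ∏ i ∈ univ.erase j, (x - μ i) := funext hq
    rw [this]; fun_prop
  -- sign at μ k
  have hmid : ∀ k : Fin m, 0 < (-1 : ℝ) ^ (m - (k : ℕ)) * q (μ k) := by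
    intro k
    have e1 : q (μ k) = - (s k * ∏ i ∈ univ.erase k, (μ k - μ i)) := by
      rw [hq, Finset.prod_eq_zero (Finset.mem_univ k) (sub_self _), mul_zero, zero_sub,
        Finset.sum_eq_single k]
      · intro j _ hj
        rw [Finset.prod_eq_zero (i := k) (by simp [hj.symm]) (sub_self _), mul_zero]
      · simp
    have e2 := aux_sign (k : ℕ) (univ.erase k) (fun i => μ k - μ i)
      (fun j _ hj => sub_pos.2 (hμ hj))
      (fun j hj hj' => sub_neg.2 (hμ (lt_of_le_of_ne hj' (fun h => by
        have : j = k := h.symm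
        simp [this] at hj))))
    have e3 : #((univ.erase k).filter fun j : Fin m => (k : ℕ) ≤ (j : ℕ)) + 1 = m - k := by
      rw [← aux_card (m := m) k, Finset.filter_erase, Finset.card_erase_add_one]
      simp
    rw [e1, ← e3, pow_succ]
    have := mul_pos (hs k) e2
    nlinarith
  set S := ∑ j, s j with hS
  have hS0 : 0 ≤ S := Finset.sum_nonneg fun j _ => (hs j).le
  set B := ∑ j, |μ j| with hB
  have hBj : ∀ j, |μ j| ≤ B := fun j =>
    Finset.single_le_sum (f := fun j => |μ j|) (fun i _ => abs_nonneg _) (Finset.mem_univ j)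
  have hfac : ∀ x, (∀ j, x - μ j ≠ 0) →
      q x = (x - a - ∑ j, s j * (x - μ j)⁻¹) * ∏ j, (x - μ j) := by
    intro x hx
    rw [hq, sub_mul _ (∑ j, _), Finset.sum_mul]
    congr 1
    refine Finset.sum_congr rfl fun j _ => ?_
    rw [← Finset.mul_prod_erase univ _ (Finset.mem_univ j)]
    have := hx j
    field_simp
  set R := B + |a| + S + 1 with hR
  have hB0 : 0 ≤ B := Finset.sum_nonneg fun j _ => abs_nonneg _
  have hhi : 0 < q R := by
    have h1 : ∀ j, 1 ≤ R - μ j := fun j => by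
      have := hBj j; have := le_abs_self (μ j); have := abs_nonneg a; linarith
    rw [hfac R (fun j => by have := h1 j; linarith)]
    refine mul_pos ?_ (Finset.prod_pos fun j _ => by have := h1 j; linarith)
    have : ∑ j, s j * (R - μ j)⁻¹ ≤ S := Finset.sum_le_sum fun j _ =>
      mul_le_of_le_one_right (hs j).le (inv_le_one_of_one_le₀ (h1 j))
    have := le_abs_self a
    linarith
  have hlo : 0 < (-1 : ℝ) ^ (m + 1) * q (-R) := by
    have h1 : ∀ j, 1 ≤ -(-R - μ j) := fun j => by
      have := hBj j; have := neg_abs_le (μ j); have := abs_nonneg a; linarith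
    rw [hfac (-R) (fun j => by have := h1 j; linarith)]
    have e2 := aux_sign 0 univ (fun i => -R - μ i) (fun j _ hj => by omega)
      (fun j _ _ => by have := h1 j; linarith)
    rw [aux_card, Nat.sub_zero] at e2
    have h3 : - S ≤ ∑ j, s j * (-R - μ j)⁻¹ := by
      rw [hS, ← Finset.sum_neg_distrib]
      refine Finset.sum_le_sum fun j _ => ?_
      have := mul_le_of_le_one_right (hs j).le (inv_le_one_of_one_le₀ (h1 j))
      rw [inv_neg] at this
      linarith
    have h4 := neg_abs_le a
    have h5 : 0 < -(-R - a - ∑ j, s j * (-R - μ j)⁻¹) := by linarith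
    have := mul_pos h5 e2
    rw [pow_succ]
    nlinarith
  -- test points
  let t : ℕ → ℝ := fun i => if i = 0 then -R else if h : i - 1 < m then μ ⟨i - 1, h⟩ else R
  have ht0 : t 0 = -R := by simp [t]
  have htm : ∀ k : Fin m, t (k + 1) = μ k := fun k => by simp [t]
  have htR : t (m + 1) = R := by simp [t]
  have hts : ∀ i ≤ m + 1, 0 < (-1 : ℝ) ^ (m + 1 - i) * q (t i) := by
    intro i hi
    rcases i with _ | i
    · simpa [ht0] using hlo
    · rcases lt_or_eq_of_le (Nat.le_of_succ_le_succ hi) with h | rfl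
      · have := hmid ⟨i, h⟩
        rw [← htm] at this
        simpa using this
      · rw [htR]; simpa using hhi
  have htt : ∀ i ≤ m, t i < t (i + 1) := by
    intro i hi
    have hup : ∀ j, μ j < R := fun j => by
      have := hBj j; have := le_abs_self (μ j); have := abs_nonneg a; linarith
    have hdn : ∀ j, -R < μ j := fun j => by
      have := hBj j; have := neg_abs_le (μ j); have := abs_nonneg a; linarith
    have hRR : -R < R := by have := abs_nonneg a; linarith
    rcases i with _ | i
    · rw [ht0]
      rcases Nat.eq_zero_or_pos m with rfl | h
      · rw [htR]; exact hRR
      · rw [htm ⟨0, h⟩]; exact hdn _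
    · rw [htm ⟨i, hi⟩]
      rcases lt_or_eq_of_le hi with h | h
      · rw [htm ⟨i + 1, h⟩]; exact hμ (by simp [Fin.lt_def])
      · have : t (i + 1 + 1) = R := by rw [← htR]; congr 2
        rw [this]; exact hup _
  have hroot : ∀ k : Fin (m+1), ∃ y, t k < y ∧ y < t (k + 1) ∧ q y = 0 := by
    intro k
    have hk : (k : ℕ) ≤ m := Nat.le_of_lt_succ k.2
    have p1 := hts k (by omega)
    have p2 := hts (k + 1) (by omega)
    have e : m + 1 - (k : ℕ) = (m + 1 - (k + 1)) + 1 := by omega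
    rw [e, pow_succ] at p1
    set ε := (-1 : ℝ) ^ (m + 1 - ((k : ℕ) + 1)) with hε
    have hlt := htt k hk
    have hc : ContinuousOn (fun x => ε * q x) (Set.Icc (t k) (t (k + 1))) := by fun_prop
    have := intermediate_value_Ioo hlt.le hc
    obtain ⟨y, hy, hy0⟩ := this (show (0:ℝ) ∈ _ from ⟨by nlinarith, p2⟩)
    refine ⟨y, hy.1, hy.2, ?_⟩
    have hε0 : ε ≠ 0 := by rw [hε]; exact pow_ne_zero _ (by norm_num)
    exact (mul_eq_zero.1 hy0).resolve_left hε0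
  choose lam h1 h2 h3 using hroot
  refine ⟨lam, h3, fun k => ⟨?_, ?_⟩⟩
  · have := h2 k.castSucc; rw [← htm]; simpa using this
  · have := h1 k.succ; rw [← htm]; simpa using this

theorem aux_charpoly {m : ℕ} (p : ℂ[X]) (hp : p.Monic) (hd : p.natDegree = m)
    (lam : Fin m → ℝ) (hl : StrictMono lam) (h : ∀ k, p.eval (lam k : ℂ) = 0) :
    p = ∏ j, (X - C ((lam j : ℂ))) := by
  have hinj : Function.Injective fun k => (lam k : ℂ) :=
    fun i j hij => hl.injective (Complex.ofReal_injective hij)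
  have hmon : (∏ j, (X - C ((lam j : ℂ)))).Monic := monic_prod_of_monic _ _ fun j _ => monic_X_sub_C _
  have hdeg : (∏ j, (X - C ((lam j : ℂ)))).natDegree = m := by
    rw [natDegree_prod_of_monic _ _ fun j _ => monic_X_sub_C _]; simp
  refine eq_of_degree_sub_lt_of_eval_index_eq (s := univ) (v := fun k => (lam k : ℂ))
    hinj.injOn ?_ ?_
  · have hdp : p.degree = m := by rw [degree_eq_natDegree hp.ne_zero, hd]
    rw [Finset.card_univ, Fintype.card_fin, ← hdp]
    refine degree_sub_lt_left ?_ hp.ne_zero ?_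
    · rw [hdp, degree_eq_natDegree hmon.ne_zero, hdeg]
    · rw [hp.leadingCoeff, hmon.leadingCoeff]
  · intro i _
    rw [h, eval_prod, Finset.prod_eq_zero (Finset.mem_univ i) (by simp)]

/-- if `β = b_1⋯b_n` is nonreal and `a_n ∈ ℝ`, then all eigenvalues of
`J_n` are real and simple and strictly interlace the eigenvalues of `J_{n−1}`:
`λ_k < μ_k < λ_{k+1}` for all `k = 1,…,n−1`. -/
theorem stmt10 (n : ℕ) (hn : 3 ≤ n) (c : ℕ → ℝ) (b : ℕ → ℂ) (a : ℝ)
    (hb : ∀ k : ℕ, k < n → b k ≠ 0)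
    (hβ : (∏ k ∈ Finset.range n, b k).im ≠ 0)
    (μ : Fin (n - 1) → ℝ) (hμ : StrictMono μ)
    (hchar : (cornerJacobiSub n c b (a : ℂ)).charpoly = ∏ j, (X - C ((μ j : ℂ)))) :
    ∃ lam : Fin n → ℝ, StrictMono lam ∧
      (cornerJacobi n c b (a : ℂ)).charpoly = ∏ j, (X - C ((lam j : ℂ))) ∧
      ∀ k : Fin (n - 1),
        lam ⟨(k : ℕ), by omega⟩ < μ k ∧ μ k < lam ⟨(k : ℕ) + 1, by have := k.2; omega⟩ := by
  obtain ⟨m, rfl⟩ : ∃ m, n = m + 1 := ⟨n - 1, by omega⟩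
  have hm : 2 ≤ m := by omega
  have hJ := aux_herm (m + 1) hn c b a
  have ha : cornerJacobi (m + 1) c b (a : ℂ) (Fin.last m) (Fin.last m) = a := by
    simp [cornerJacobi]
  obtain ⟨v, hv, hq⟩ := aux_secular (cornerJacobi (m + 1) c b (a : ℂ)) hJ a ha μ hμ.injective hchar
  obtain ⟨lam, h0, hl⟩ := aux_roots a μ
    (fun j => Complex.normSq
      (∑ i, cornerJacobi (m + 1) c b (a : ℂ) (Fin.last m) i.castSucc * v j i)) hμ
    (fun j => Complex.normSq_pos.2 fun h =>
      (hv j).1 (aux_nondeg m hm c b a (μ j) hb hβ (v j) (hv j).2 h))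
    _ (fun x => rfl)
  have hmono : StrictMono lam := Fin.strictMono_iff_lt_succ.2 fun k => (hl k).1.trans (hl k).2
  refine ⟨lam, hmono, ?_, fun k => hl k⟩
  refine aux_charpoly _ (Matrix.charpoly_monic _) (by simp) lam hmono fun k => ?_
  rw [hq]
  exact_mod_cast h0 k
end
end

section
/- Let J_n ∈ 𝒥_n with β = b_1⋯b_n real and nonzero, χ_n its characteristic polynomial, and μ_1 < ... < μ_{n−1} the eigenvalues of J_{n−1}. Then for every k = 1,...,n−1: (−1)^{n−k} χ_n(μ_k) ≥ 0 and |χ_n(μ_k)| ≥ 4(−1)^{n−k−1} β. -/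
open Polynomial Matrix Finset

noncomputable section

theorem det_bordered_aux {R : Type*} [CommRing R] {m : ℕ} (A : Matrix (Fin m) (Fin m) R)
    (u : Matrix (Fin m) (Fin 1) R) (v : Matrix (Fin 1) (Fin m) R) (d : Matrix (Fin 1) (Fin 1) R)
    (h : IsRightRegular A.det) :
    (fromBlocks A u v d).det = d 0 0 * A.det - (v * A.adjugate * u) 0 0 := by
  apply h
  have h1 : fromBlocks A u v d * fromBlocks 1 (-(A.adjugate * u)) 0 (A.det • (1 : Matrix (Fin 1) (Fin 1) R))
      = fromBlocks A 0 v (A.det • d - v * A.adjugate * u) := by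
    rw [fromBlocks_multiply]
    congr 1
    · simp
    · rw [Matrix.mul_neg, ← Matrix.mul_assoc, Matrix.mul_adjugate]; simp
    · simp
    · rw [Matrix.mul_neg, ← Matrix.mul_assoc]; simp [sub_eq_add_neg, add_comm]
  have h2 := congrArg Matrix.det h1
  rw [det_mul, det_fromBlocks_zero₂₁, det_fromBlocks_zero₁₂] at h2
  simp only [det_one, one_mul, det_fin_one, Matrix.sub_apply, Matrix.smul_apply, one_apply_eq, smul_eq_mul, mul_one] at h2
  simp only
  rw [h2]; ring

theorem det_bordered {R : Type*} [CommRing R] {m : ℕ} (M : Matrix (Fin (m+1)) (Fin (m+1)) R)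
    (A : Matrix (Fin m) (Fin m) R) (hA : A = M.submatrix Fin.castSucc Fin.castSucc)
    (h : IsRightRegular A.det) :
    M.det = M (Fin.last m) (Fin.last m) * A.det -
      ∑ j, (∑ i, M (Fin.last m) (Fin.castSucc i) * A.adjugate i j) * M (Fin.castSucc j) (Fin.last m) := by
  have h1 : M.submatrix finSumFinEquiv finSumFinEquiv = fromBlocks A
      (Matrix.of fun i _ => M (Fin.castSucc i) (Fin.last m))
      (Matrix.of fun _ i => M (Fin.last m) (Fin.castSucc i))
      (Matrix.of fun _ _ => M (Fin.last m) (Fin.last m)) := by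
    subst hA
    have hl : ∀ x : Fin 1, Fin.natAdd m x = Fin.last m := by
      intro x; ext; simp
    ext i j
    rcases i with i | i <;> rcases j with j | j <;> simp [hl] <;> rfl
  rw [← det_submatrix_equiv_self finSumFinEquiv M, h1, det_bordered_aux _ _ _ _ h]
  simp [Matrix.mul_apply]

theorem charpoly_bordered {m : ℕ} (M : Matrix (Fin (m+1)) (Fin (m+1)) ℂ)
    (A : Matrix (Fin m) (Fin m) ℂ) (hA : A = M.submatrix Fin.castSucc Fin.castSucc) (x : ℂ)
    (hx : A.charpoly.eval x = 0) :
    M.charpoly.eval x = -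
      ∑ j, (∑ i, M (Fin.last m) (Fin.castSucc i) * (Matrix.scalar _ x - A).adjugate i j)
        * M (Fin.castSucc j) (Fin.last m) := by
  have h1 := det_bordered M.charmatrix A.charmatrix (by
    subst hA
    ext1 i j
    simp [charmatrix_apply, diagonal_apply]) (by
    have := A.charpoly_monic
    exact (IsRegular.of_ne_zero this.ne_zero).right)
  have h2 : ∀ i j, (A.charmatrix.adjugate i j).eval x = (Matrix.scalar _ x - A).adjugate i j := by
    intro i j
    have := (Polynomial.evalRingHom x).map_adjugate A.charmatrix
    have h3 : (Polynomial.evalRingHom x).mapMatrix A.charmatrix = Matrix.scalar _ x - A := by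
      ext i j
      by_cases h : i = j <;> simp [charmatrix_apply, h]
    rw [h3] at this
    rw [← this]; rfl
  change M.charmatrix.det.eval x = _
  rw [h1]
  change A.charmatrix.det.eval x = _ at hx
  simp only [eval_sub, eval_mul, hx, eval_finsetSum, h2]
  have h4 : ∀ i : Fin m, (M.charmatrix (Fin.last m) (Fin.castSucc i)).eval x = - M (Fin.last m) (Fin.castSucc i) := by
    intro i
    rw [charmatrix_apply_ne _ _ _ (Fin.castSucc_lt_last i).ne']; simp
  have h5 : ∀ i : Fin m, (M.charmatrix (Fin.castSucc i) (Fin.last m)).eval x = - M (Fin.castSucc i) (Fin.last m) := by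
    intro i
    rw [charmatrix_apply_ne _ _ _ (Fin.castSucc_lt_last i).ne]; simp
  simp [h4, h5]

theorem adj_rank_one {m : ℕ} (A : Matrix (Fin m) (Fin m) ℂ) (hA : A.IsHermitian)
    (μ : Fin m → ℝ) (hμ : StrictMono μ)
    (hchar : A.charpoly = ∏ j, (X - C ((μ j : ℂ)))) (k : Fin m) :
    ∃ w : Fin m → ℂ, ∀ i j, (Matrix.scalar _ (μ k : ℂ) - A).adjugate i j =
      ((∏ l ∈ univ.erase k, (μ k - μ l) : ℝ) : ℂ) * (w i * star (w j)) := by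
  set e := hA.eigenvalues with he
  have hc := hA.charpoly_eq
  have hroots : univ.val.map (fun i => (e i : ℂ)) = univ.val.map (fun i => (μ i : ℂ)) := by
    have h1 := hA.roots_charpoly_eq_eigenvalues
    rw [hchar, Polynomial.roots_prod _ _ (by simp [Finset.prod_ne_zero_iff, Polynomial.X_sub_C_ne_zero])] at h1
    simp only [roots_X_sub_C, Multiset.bind_singleton] at h1
    exact h1.symm
  have hroots' : univ.val.map e = univ.val.map μ := by
    have := congrArg (Multiset.map Complex.re) hroots
    simpa [Multiset.map_map, Function.comp_def] using this
  have hinj : Function.Injective e := by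
    rw [← Fintype.nodup_map_univ_iff_injective, hroots', Fintype.nodup_map_univ_iff_injective]
    exact hμ.injective
  obtain ⟨i0, hi0⟩ : ∃ i, e i = μ k := by
    have : μ k ∈ univ.val.map e := by rw [hroots']; simp
    simpa using this
  have hprod : ∏ l ∈ univ.erase i0, (μ k - e l) = ∏ l ∈ univ.erase k, (μ k - μ l) := by
    have h1 : (univ.erase i0).val.map e = (univ.erase k).val.map μ := by
      rw [Finset.erase_val, Finset.erase_val, Multiset.map_erase _ hinj, Multiset.map_erase _ hμ.injective, hroots', hi0]
    have := congrArg (fun s => (Multiset.map (fun y => μ k - y) s).prod) h1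
    simpa [Multiset.map_map, Function.comp_def, Finset.prod] using this
  set U : Matrix (Fin m) (Fin m) ℂ := (hA.eigenvectorUnitary : Matrix (Fin m) (Fin m) ℂ) with hU
  have hUU : U * star U = 1 := Unitary.coe_mul_star_self _
  have hsp : A = U * diagonal (RCLike.ofReal ∘ e) * star U := by
    have := hA.spectral_theorem
    rwa [Unitary.conjStarAlgAut_apply] at this
  have hadj : (Matrix.scalar _ (μ k : ℂ) - A) = U * diagonal (fun i => (μ k : ℂ) - e i) * star U := by
    have : diagonal (fun i => (μ k : ℂ) - e i) = Matrix.scalar _ (μ k : ℂ) - diagonal (RCLike.ofReal ∘ e) := by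
      ext i j; by_cases h : i = j <;> simp [h]
    rw [this, Matrix.mul_sub, Matrix.sub_mul, ← hsp]
    congr 1
    rw [← (Matrix.scalar_commute (μ k : ℂ) (fun _ => Commute.all _ _) U).eq, Matrix.mul_assoc, hUU, Matrix.mul_one]
  have hU' : star U * U = 1 := Unitary.coe_star_mul_self _
  have hdet : U.det * (star U).det = 1 := by rw [← det_mul, hUU, det_one]
  have hadjU : adjugate U = U.det • star U := by
    calc adjugate U = adjugate U * (U * star U) := by rw [hUU, Matrix.mul_one]
      _ = _ := by rw [← Matrix.mul_assoc, adjugate_mul]; simp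
  have hadjU' : adjugate (star U) = (star U).det • U := by
    calc adjugate (star U) = adjugate (star U) * (star U * U) := by rw [hU', Matrix.mul_one]
      _ = _ := by rw [← Matrix.mul_assoc, adjugate_mul]; simp
  refine ⟨fun i => U i i0, fun i j => ?_⟩
  rw [hadj, adjugate_mul_distrib, adjugate_mul_distrib, hadjU, hadjU', adjugate_diagonal]
  simp only [Matrix.smul_mul, Matrix.mul_smul, smul_smul]
  rw [hdet, one_smul]
  rw [← Matrix.mul_assoc, Matrix.mul_apply, Finset.sum_eq_single i0]
  · rw [Matrix.mul_diagonal, ← hprod]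
    push_cast
    simp [Matrix.star_apply]
    ring
  · intro l _ hl
    rw [Matrix.mul_diagonal, Finset.prod_eq_zero (i := i0)]
    · simp
    · simp [hl.symm]
    · simp [hi0]
  · simp

theorem adj_corner (m : ℕ) (c : ℕ → ℝ) (b : ℕ → ℂ) (a : ℂ) (x : ℂ)
    (A : Matrix (Fin (m+1)) (Fin (m+1)) ℂ) (hA : A = cornerJacobiSub (m+2) c b a) :
    (Matrix.scalar (Fin (m+1)) x - A).adjugate 0 (Fin.last m)
      = ∏ j ∈ Finset.range m, b j := by
  rw [adjugate_fin_succ_eq_det_submatrix, det_of_isLowerTriangular]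
  · have : ∀ i : Fin m, ((Matrix.scalar (Fin (m+1)) x - A).submatrix (Fin.last m).succAbove (Fin.succAbove 0)) i i = - b i := by
      intro i
      have h1 : (i.castSucc : Fin (m+1)) ≠ i.succ := by
        intro h; have := congrArg Fin.val h; simp at this
      have := i.2
      simp [hA, cornerJacobiSub, cornerJacobi, Matrix.diagonal_apply_ne _ h1]
      grind
    rw [Finset.prod_congr rfl (fun i _ => this i), Finset.prod_neg, ← mul_assoc]
    simp only [Fin.val_last, Fin.val_zero, add_zero, Finset.card_univ, Fintype.card_fin]
    rw [← pow_add, Even.neg_one_pow ⟨m, rfl⟩, one_mul, Finset.prod_range]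
  · intro i j hij
    have hij' : (i : ℕ) < j := hij
    have h1 : (i.castSucc : Fin (m+1)) ≠ j.succ := by
      intro h; have := congrArg Fin.val h; simp at this; omega
    have := j.2
    simp [hA, cornerJacobiSub, cornerJacobi, Matrix.diagonal_apply_ne _ h1]
    grind

theorem sub_hermitian (m : ℕ) (c : ℕ → ℝ) (b : ℕ → ℂ) (a : ℂ) :
    (cornerJacobiSub (m+2) c b a).IsHermitian := by
  ext i j
  have hi : (i : ℕ) < m + 1 := i.2
  have hj : (j : ℕ) < m + 1 := j.2
  simp only [conjTranspose_apply, cornerJacobiSub, cornerJacobi, submatrix_apply, of_apply, Fin.val_castLE]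
  by_cases h : (i : ℕ) = j
  · have : ¬ (j : ℕ) = m + 1 := by omega
    simp [h, this]
  · have h' : ¬ (j : ℕ) = i := fun t => h t.symm
    have h1 : ¬ (i : ℕ) = m + 1 := by omega
    have h2 : ¬ (j : ℕ) = m + 1 := by omega
    by_cases h3 : (i : ℕ) + 1 = j
    · have h4 : ¬ (j : ℕ) + 1 = i := by omega
      simp [h, h', h1, h2, h3, h4]
    · by_cases h4 : (j : ℕ) + 1 = i <;> simp [h, h', h1, h2, h3, h4]

theorem prod_sign {m : ℕ} (μ : Fin (m+1) → ℝ) (hμ : StrictMono μ) (k : Fin (m+1)) :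
    0 ≤ (-1 : ℝ) ^ (m - (k : ℕ)) * ∏ l ∈ univ.erase k, (μ k - μ l) := by
  have hs : univ.erase k = Finset.Iio k ∪ Finset.Ioi k := by
    ext l; simp [lt_or_lt_iff_ne]
  have hd : Disjoint (Finset.Iio k) (Finset.Ioi k) := by
    rw [Finset.disjoint_left]; intro l h1 h2
    simp at h1 h2; exact absurd h1 h2.not_gt
  rw [hs, Finset.prod_union hd]
  have h1 : 0 ≤ ∏ l ∈ Finset.Iio k, (μ k - μ l) :=
    Finset.prod_nonneg fun l hl => sub_nonneg.2 (hμ.monotone (Finset.mem_Iio.1 hl).le)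
  have h2 : 0 ≤ ∏ l ∈ Finset.Ioi k, (μ l - μ k) :=
    Finset.prod_nonneg fun l hl => sub_nonneg.2 (hμ.monotone (Finset.mem_Ioi.1 hl).le)
  have h3 : ∏ l ∈ Finset.Ioi k, (μ k - μ l) = (-1) ^ (m - (k : ℕ)) * ∏ l ∈ Finset.Ioi k, (μ l - μ k) := by
    have : (Finset.Ioi k).card = m - (k : ℕ) := by rw [Fin.card_Ioi]; omega
    rw [← this, ← Finset.prod_neg]
    simp
  rw [h3]
  have h4 : (-1 : ℝ) ^ (m - (k : ℕ)) * (-1 : ℝ) ^ (m - (k : ℕ)) = 1 := by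
    rw [← pow_add, Even.neg_one_pow ⟨_, rfl⟩]
  calc (0:ℝ) ≤ (∏ l ∈ Finset.Iio k, (μ k - μ l)) * ∏ l ∈ Finset.Ioi k, (μ l - μ k) := mul_nonneg h1 h2
    _ = ((-1 : ℝ) ^ (m - (k : ℕ)) * (-1 : ℝ) ^ (m - (k : ℕ))) * ((∏ l ∈ Finset.Iio k, (μ k - μ l)) * ∏ l ∈ Finset.Ioi k, (μ l - μ k)) := by rw [h4, one_mul]
    _ = _ := by ring

theorem final_ineq (s d : ℝ) (p q β χ : ℂ) (hs : s = 1 ∨ s = -1) (hd : 0 ≤ s * d)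
    (hβ : β = d * (p * star q)) (hχ : χ = -(d * ((p + q) * star (p + q)))) :
    χ.im = 0 ∧ 0 ≤ -s * χ.re ∧ 4 * s * β.re ≤ |χ.re| := by
  have hre : χ.re = -(d * ((p.re + q.re)^2 + (p.im+q.im)^2)) := by
    rw [hχ]
    simp only [Complex.star_def, Complex.neg_re, Complex.mul_re, Complex.mul_im, Complex.add_re, Complex.add_im,
      Complex.conj_re, Complex.conj_im, Complex.ofReal_re, Complex.ofReal_im]
    ring
  have hβr : β.re = d * (p.re * q.re + p.im * q.im) := by
    rw [hβ]; simp
  have him : χ.im = 0 := by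
    rw [hχ]; simp; ring_nf; simp
  have hle : -s * χ.re = s * d * ((p.re + q.re)^2 + (p.im+q.im)^2) := by rw [hre]; ring
  have h2 : 0 ≤ -s * χ.re := by rw [hle]; positivity
  refine ⟨him, h2, ?_⟩
  have h3 : -s * χ.re ≤ |χ.re| := by
    rcases hs with rfl | rfl
    · simpa using neg_le_abs χ.re
    · simpa using le_abs_self χ.re
  refine le_trans ?_ h3
  rw [hle, hβr]
  have : 0 ≤ (s * d) * ((p.re - q.re)^2 + (p.im - q.im)^2) := by positivity
  nlinarith

/-- necessary conditions for real nonzero `β = b_1⋯b_n`: for every `k`,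
`χ_n(μ_k)` is real, `(−1)^{n−k} χ_n(μ_k) ≥ 0`, and `|χ_n(μ_k)| ≥ 4 (−1)^{n−k−1} β`
(here stated with the 0-based exponent `n − k`, which has the same parity as the
1-based `n − k − 1`... namely `(−1)^{n-k_0-2} = (−1)^{n-k_0}` for 0-based `k_0`). -/
theorem stmt15 (n : ℕ) (hn : 3 ≤ n) (c : ℕ → ℝ) (b : ℕ → ℂ) (a : ℂ)
    (hb : ∀ k : ℕ, k < n → b k ≠ 0)
    (hβreal : (∏ j ∈ Finset.range n, b j).im = 0)
    (hβne : (∏ j ∈ Finset.range n, b j) ≠ 0)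
    (μ : Fin (n - 1) → ℝ) (hμ : StrictMono μ)
    (hchar : (cornerJacobiSub n c b a).charpoly = ∏ j, (X - C ((μ j : ℂ)))) :
    ∀ k : Fin (n - 1),
      (((cornerJacobi n c b a).charpoly.eval ((μ k : ℂ))).im = 0) ∧
      (0 ≤ (-1 : ℝ) ^ (n - 1 - (k : ℕ))
          * (((cornerJacobi n c b a).charpoly.eval ((μ k : ℂ))).re)) ∧
      (4 * (-1 : ℝ) ^ (n - (k : ℕ)) * (∏ j ∈ Finset.range n, b j).re
        ≤ |(((cornerJacobi n c b a).charpoly.eval ((μ k : ℂ))).re)|) := by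
  obtain ⟨m, rfl⟩ : ∃ m, n = m + 2 := ⟨n - 2, by omega⟩
  intro k
  have hm : 1 ≤ m := by omega
  change Fin (m + 1) at k
  change Fin (m + 1) → ℝ at μ
  have hA := sub_hermitian m c b a
  obtain ⟨w, hw⟩ := adj_rank_one (m := m + 1) (cornerJacobiSub (m+2) c b a) hA μ hμ hchar k
  have hcor := adj_corner m c b a (μ k : ℂ) _ rfl
  have hroot : (cornerJacobiSub (m+2) c b a).charpoly.eval (μ k : ℂ) = 0 := by
    rw [hchar, eval_prod]
    exact Finset.prod_eq_zero (Finset.mem_univ k) (by simp)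
  have hbd := charpoly_bordered (m := m + 1) (cornerJacobi (m+2) c b a)
    (cornerJacobiSub (m+2) c b a) rfl (μ k : ℂ) hroot
  have hsgn := prod_sign μ hμ k
  set d : ℝ := ∏ l ∈ univ.erase k, (μ k - μ l) with hd
  have hcor' : (d : ℂ) * (w 0 * star (w (Fin.last m))) = ∏ j ∈ Finset.range m, b j := by
    rw [← hcor]; exact (hw 0 (Fin.last m)).symm
  have h0l : (0 : Fin (m+1)) ≠ Fin.last m := by
    intro h; have := congrArg Fin.val h; simp at this; omega
  have hrow : ∀ i : Fin (m+1), cornerJacobi (m+2) c b a (Fin.last (m+1)) (Fin.castSucc i) =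
      (if i = 0 then b (m+1) else 0) + (if i = Fin.last m then star (b m) else 0) := by
    intro i
    have := i.2
    simp only [cornerJacobi, of_apply, Fin.ext_iff, Fin.val_last, Fin.val_castSucc, Fin.val_zero]
    have e1 : m + 2 - 1 = m + 1 := rfl
    rw [e1]
    have e2 : star (b m) = (starRingEnd ℂ) (b m) := rfl
    rw [e2]
    clear hw hcor hcor' hbd
    grind
  have hcol : ∀ i : Fin (m+1), cornerJacobi (m+2) c b a (Fin.castSucc i) (Fin.last (m+1)) =
      star ((if i = 0 then b (m+1) else 0) + (if i = Fin.last m then star (b m) else 0)) := by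
    intro i
    have := i.2
    by_cases h1 : i = 0
    · subst h1
      simp [cornerJacobi, h0l]
    · by_cases h2 : i = Fin.last m
      · subst h2
        have : ¬ m = 0 := by omega
        simp [cornerJacobi, h1, this]
      · have h1' : ¬ (i : ℕ) = 0 := fun h => h1 (Fin.ext h)
        have h2' : ¬ (i : ℕ) = m := fun h => h2 (Fin.ext h)
        simp [cornerJacobi, h1, h2, h2']
        grind
  have hz : ∑ i : Fin (m+1), ((if i = 0 then b (m+1) else 0) +
      (if i = Fin.last m then star (b m) else 0)) * w i
      = b (m+1) * w 0 + star (b m) * w (Fin.last m) := by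
    simp [add_mul, Finset.sum_add_distrib]
  have hχ : (cornerJacobi (m+2) c b a).charpoly.eval (μ k : ℂ) =
      -(d * ((b (m+1) * w 0 + star (b m) * w (Fin.last m)) *
        star (b (m+1) * w 0 + star (b m) * w (Fin.last m)))) := by
    rw [← hz, star_sum, Finset.mul_sum, Finset.mul_sum, hbd]
    congr 1
    refine Finset.sum_congr rfl fun j _ => ?_
    rw [hcol, Finset.sum_mul, Finset.sum_mul, Finset.mul_sum]
    refine Finset.sum_congr rfl fun i _ => ?_
    rw [hrow, hw i j, star_mul]
    ring
  have hβ : ∏ j ∈ Finset.range (m+2), b j =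
      d * ((b (m+1) * w 0) * star (star (b m) * w (Fin.last m))) := by
    rw [Finset.prod_range_succ, Finset.prod_range_succ, ← hcor', star_mul, star_star]
    ring
  have hk : (k : ℕ) ≤ m := Nat.lt_succ_iff.1 k.2
  obtain ⟨r1, r2, r3⟩ := final_ineq ((-1 : ℝ) ^ (m - (k : ℕ))) d _ _ _ _
    (neg_one_pow_eq_or ℝ _) hsgn hβ hχ
  refine ⟨r1, ?_, ?_⟩
  · have : m + 2 - 1 - (k : ℕ) = (m - (k : ℕ)) + 1 := by omega
    rw [this, pow_succ, mul_neg_one]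
    exact r2
  · have : m + 2 - (k : ℕ) = (m - (k : ℕ)) + 2 := by omega
    rw [this, pow_add, neg_one_sq, mul_one]
    exact r3
end
end
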